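/- arXiv:1804.09597 — 2 statements merged into one kernel-verified Lean document; each statement's English description precedes it below -/
import Mathlib

section
/- Let G=(V,E,W) be a connected empirical graph with no self-loops, M ⊆ V a sampling set with labels (x̃_i)_{i∈M}, and Γ = diag(1/(2d_i))_{i∈V}, Λ = diag(1/(2W_e))_{e∈E}. Let x̂_SLP ∈ argmin_{x∈Q} ‖Dx‖₁ and assume there exists ŷ_SLP ∈ ℝ^E with ‖ŷ_SLP‖_∞ ≤ 1 such that (x̂_SLP, ŷ_SLP) is a saddle point of L, i.e. L(x̂_SLP, y) ≤ L(x̂_SLP, ŷ_SLP) ≤ L(x, ŷ_SLP) for all x ∈ Q and all y with ‖y‖_∞ ≤ 1, and L(x̂_SLP, ŷ_SLP) = ‖D x̂_SLP‖₁. Let (x̂^{(k)}, ŷ^{(k)})_{k≥0} be generated by the SLP update rule from arbitrary initializations x̂^{(−1)} = x̂^{(0)} ∈ ℝ^V and ŷ^{(0)} ∈ ℝ^E. Then for every K ≥ 1 the averages x̄^{(K)} = (1/K) Σ_{k=1}^{K} x̂^{(k)} satisfy ‖x̄^{(K)}‖_TV − ‖x̂_SLP‖_TV ≤ (1/(2K))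 ( ‖x̂^{(0)} − x̂_SLP‖²_{Γ⁻¹} + ‖ŷ^{(0)} − ỹ^{(K)}‖²_{Λ⁻¹} ), where ỹ^{(K)} = sign(D x̄^{(K)}) is the entrywise signum vector (with sign(0)=0). -/
open Matrix Finset

noncomputable section

/-- The ℓ¹-norm of a finitely indexed real vector. -/
def l1Norm {ι : Type*} [Fintype ι] (u : ι → ℝ) : ℝ := ∑ i, |u i|

/-- The squared weighted norm `‖u‖²_Q = uᵀ Q u`. -/
def wnormSq {ι : Type*} [Fintype ι] (Q : Matrix ι ι ℝ) (u : ι → ℝ) : ℝ := u ⬝ᵥ (Q *ᵥ u)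

/-- The closed ℓ∞ unit ball `{y : ‖y‖_∞ ≤ 1}`. -/
def linfBall (ι : Type*) : Set (ι → ℝ) := {y | ∀ e, |y e| ≤ 1}

/-- `a` minimizes `f` over the set `S`. -/
def IsMinimizer {α : Type*} (S : Set α) (f : α → ℝ) (a : α) : Prop :=
  a ∈ S ∧ ∀ b ∈ S, f a ≤ f b

/-- Entrywise square root of the diagonal matrix with diagonal `g`. -/
def diagSqrt {ι : Type*} [Fintype ι] [DecidableEq ι] (g : ι → ℝ) : Matrix ι ι ℝ :=
  Matrix.diagonal (fun i => Real.sqrt (g i))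

/-- The spectral norm `‖A‖₂ = sup_{‖u‖₂ = 1} ‖A u‖₂` of a real matrix. -/
def specNorm {m n : Type*} [Fintype m] [Fintype n] [DecidableEq n] (A : Matrix m n ℝ) : ℝ :=
  ‖LinearMap.toContinuousLinearMap (Matrix.toEuclideanLin A)‖

/-- Objective of the dual resolvent step: `z ↦ ½ (ŷ + Λ D x̄ − z)ᵀ Λ⁻¹ (ŷ + Λ D x̄ − z)`. -/
def slpDualObj {V E : Type*} [Fintype V] [Fintype E] [DecidableEq E]
    (D : Matrix E V ℝ) (Λ : Matrix E E ℝ) (yk : E → ℝ) (xbar : V → ℝ) (z : E → ℝ) : ℝ :=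
  (1/2) * wnormSq Λ⁻¹ (yk + Λ *ᵥ (D *ᵥ xbar) - z)

/-- Objective of the primal resolvent step: `z ↦ ½ (x̂ − Γ Dᵀ v − z)ᵀ Γ⁻¹ (x̂ − Γ Dᵀ v − z)`. -/
def slpPrimalObj {V E : Type*} [Fintype V] [Fintype E] [DecidableEq V]
    (D : Matrix E V ℝ) (Γ : Matrix V V ℝ) (xk : V → ℝ) (v : E → ℝ) (z : V → ℝ) : ℝ :=
  (1/2) * wnormSq Γ⁻¹ (xk - Γ *ᵥ (Dᵀ *ᵥ v) - z)

/-- The SLP update rule: starting from `xs 0` (with `x^{(-1)} = x^{(0)}`, encoded via truncated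
subtraction `0 - 1 = 0`) and `ys 0`, the iterate `ys (k+1)` minimizes the dual resolvent
objective over the ℓ∞ unit ball and `xs (k+1)` minimizes the primal resolvent objective
over the constraint set `Q`. -/
def SLPSequences {V E : Type*} [Fintype V] [Fintype E] [DecidableEq V] [DecidableEq E]
    (D : Matrix E V ℝ) (Γ : Matrix V V ℝ) (Λ : Matrix E E ℝ) (Q : Set (V → ℝ))
    (xs : ℕ → V → ℝ) (ys : ℕ → E → ℝ) : Prop :=
  ∀ k : ℕ,
    IsMinimizer (linfBall E) (slpDualObj D Λ (ys k) ((2:ℝ) • xs k - xs (k-1))) (ys (k+1)) ∧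
    IsMinimizer Q (slpPrimalObj D Γ (xs k) (ys (k+1))) (xs (k+1))

/-- An empirical graph: an undirected weighted graph together with a fixed orientation
assigning each edge `e` a head `e⁺` and a tail `e⁻`, with positive weights, no self-loops,
and distinct edges joining distinct node pairs. -/
structure EmpiricalGraph (V E : Type*) where
  head : E → V
  tail : E → V
  w : E → ℝ
  w_pos : ∀ e, 0 < w e
  no_self_loop : ∀ e, head e ≠ tail e
  edge_inj : Function.Injective (fun e => ({head e, tail e} : Set V))

/-- The simple graph underlying an empirical graph. -/
def EmpiricalGraph.toSimpleGraph {V E : Type*} (G : EmpiricalGraph V E) : SimpleGraph V :=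
  SimpleGraph.fromRel (fun i j => ∃ e, G.head e = i ∧ G.tail e = j)

/-- Weighted node degree `d_i = ∑_{j ∈ N(i)} W_{i,j}`. -/
def EmpiricalGraph.deg {V E : Type*} [Fintype E] [DecidableEq V]
    (G : EmpiricalGraph V E) (i : V) : ℝ :=
  ∑ e, ((if G.head e = i then G.w e else 0) + (if G.tail e = i then G.w e else 0))

/-- Weighted oriented incidence matrix `D ∈ ℝ^{E×V}`: `D_{e,e⁺} = W_e`, `D_{e,e⁻} = −W_e`. -/
def EmpiricalGraph.incidence {V E : Type*} [DecidableEq V]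
    (G : EmpiricalGraph V E) : Matrix E V ℝ :=
  Matrix.of fun e i => if G.head e = i then G.w e else if G.tail e = i then -G.w e else 0


section WeightedNorm

variable {ι : Type*} [Fintype ι]

lemma dotProduct_mulVec_swap {A : Matrix ι ι ℝ} (hA : A.IsSymm) (u v : ι → ℝ) :
    u ⬝ᵥ (A *ᵥ v) = v ⬝ᵥ (A *ᵥ u) := by
  rw [dotProduct_mulVec, ← mulVec_transpose, hA.eq, dotProduct_comm]

lemma wnormSq_sub {A : Matrix ι ι ℝ} (hA : A.IsSymm) (u v : ι → ℝ) :
    wnormSq A (u - v) = wnormSq A u - 2 * (u ⬝ᵥ (A *ᵥ v)) + wnormSq A v := by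
  simp only [wnormSq, mulVec_sub, dotProduct_sub, sub_dotProduct]
  rw [dotProduct_mulVec_swap hA v u]
  ring

lemma wnormSq_smul (A : Matrix ι ι ℝ) (t : ℝ) (u : ι → ℝ) :
    wnormSq A (t • u) = t ^ 2 * wnormSq A u := by
  simp only [wnormSq, mulVec_smul, dotProduct_smul, smul_dotProduct, smul_eq_mul]
  ring

@[simp] lemma wnormSq_zero (A : Matrix ι ι ℝ) : wnormSq A 0 = 0 := by
  simp [wnormSq]

lemma wnormSq_neg (A : Matrix ι ι ℝ) (u : ι → ℝ) : wnormSq A (-u) = wnormSq A u := by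
  simp [wnormSq, mulVec_neg]

lemma wnormSq_sub_comm (A : Matrix ι ι ℝ) (u v : ι → ℝ) :
    wnormSq A (u - v) = wnormSq A (v - u) := by
  rw [← wnormSq_neg, neg_sub]

/-- The variational inequality characterizing a weighted projection onto a convex set. -/
lemma IsMinimizer.variational_inequality {A : Matrix ι ι ℝ} (hA : A.IsSymm)
    {S : Set (ι → ℝ)} (hS : Convex ℝ S) {c a b : ι → ℝ}
    (ha : IsMinimizer S (fun z => (1 / 2) * wnormSq A (c - z)) a) (hb : b ∈ S) :
    (c - a) ⬝ᵥ (A *ᵥ (b - a)) ≤ 0 := by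
  have key : ∀ t : ℝ, 0 < t → t ≤ 1 →
      2 * ((c - a) ⬝ᵥ (A *ᵥ (b - a))) ≤ t * wnormSq A (b - a) := by
    intro t ht ht1
    have hmem : a + t • (b - a) ∈ S := hS.add_smul_sub_mem ha.1 hb ⟨ht.le, ht1⟩
    have h := ha.2 _ hmem
    simp only at h
    rw [show c - (a + t • (b - a)) = (c - a) - t • (b - a) by abel,
      wnormSq_sub hA (c - a), wnormSq_smul, mulVec_smul, dotProduct_smul, smul_eq_mul] at h
    refine le_of_mul_le_mul_left ?_ ht
    linarith
  by_contra! hpos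
  have h1 := key 1 one_pos le_rfl
  have hN : 0 < wnormSq A (b - a) := by linarith
  have h2 := key ((c - a) ⬝ᵥ (A *ᵥ (b - a)) / wnormSq A (b - a)) (by positivity)
    ((div_le_one hN).2 (by linarith))
  rw [div_mul_cancel₀ _ hN.ne'] at h2
  linarith

/-- One proximal step with a linear term `g` decreases the weighted distance to every
feasible point. -/
lemma IsMinimizer.prox_descent [DecidableEq ι] {A : Matrix ι ι ℝ} (hA : A.PosDef)
    {S : Set (ι → ℝ)} (hS : Convex ℝ S) {c g a b : ι → ℝ}
    (ha : IsMinimizer S (fun z => (1 / 2) * wnormSq A⁻¹ (c + A *ᵥ g - z)) a) (hb : b ∈ S) :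
    (b - a) ⬝ᵥ g ≤
      (1 / 2) * (wnormSq A⁻¹ (c - b) - wnormSq A⁻¹ (a - b) - wnormSq A⁻¹ (a - c)) := by
  have hsymm : (A⁻¹).IsSymm := by
    have h := hA.inv.isHermitian.eq
    rwa [conjTranspose_eq_transpose_of_trivial] at h
  have h := ha.variational_inequality hsymm hS hb
  have hg : (A *ᵥ g) ⬝ᵥ (A⁻¹ *ᵥ (b - a)) = (b - a) ⬝ᵥ g := by
    rw [dotProduct_mulVec_swap hsymm, mulVec_mulVec,
      nonsing_inv_mul _ ((isUnit_iff_isUnit_det A).1 hA.isUnit), one_mulVec]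
  rw [show c + A *ᵥ g - a = (c - a) + A *ᵥ g by abel, add_dotProduct, hg] at h
  have e : wnormSq A⁻¹ (c - b) = wnormSq A⁻¹ ((c - a) - (b - a)) := by congr 1; abel
  rw [e, wnormSq_sub hsymm, wnormSq_sub_comm _ a b, wnormSq_sub_comm _ a c]
  linarith

end WeightedNorm

lemma convex_linfBall (ι : Type*) : Convex ℝ (linfBall ι) := by
  have : linfBall ι = Set.Icc (-1) 1 := by
    ext y
    simp [linfBall, abs_le, Pi.le_def, forall_and]
  rw [this]
  exact convex_Icc _ _

lemma convex_setOf_eqOn {ι : Type*} (M : Set ι) (c : ι → ℝ) :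
    Convex ℝ {x : ι → ℝ | ∀ i ∈ M, x i = c i} := by
  intro x hx y hy a b _ _ hab i hi
  simp only [Pi.add_apply, Pi.smul_apply, smul_eq_mul, hx i hi, hy i hi, ← add_mul, hab, one_mul]

lemma dotProduct_le_l1Norm {ι : Type*} [Fintype ι] {y : ι → ℝ} (hy : y ∈ linfBall ι)
    (u : ι → ℝ) : y ⬝ᵥ u ≤ l1Norm u := by
  refine sum_le_sum fun i _ => (le_abs_self _).trans ?_
  rw [abs_mul]
  exact mul_le_of_le_one_left (abs_nonneg _) (hy i)

lemma sign_mem_linfBall {ι : Type*} (u : ι → ℝ) : (fun i => Real.sign (u i)) ∈ linfBall ι := by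
  intro i
  rcases Real.sign_apply_eq (u i) with h | h | h <;> simp [h]

lemma sign_dotProduct_self {ι : Type*} [Fintype ι] (u : ι → ℝ) :
    (fun i => Real.sign (u i)) ⬝ᵥ u = l1Norm u := by
  refine sum_congr rfl fun i _ => ?_
  rcases lt_trichotomy (u i) 0 with h | h | h
  · simp [Real.sign_of_neg h, abs_of_neg h]
  · simp [h]
  · simp [Real.sign_of_pos h, abs_of_pos h]

section PrimalDual

variable {V E : Type*} [Fintype V] [Fintype E] [DecidableEq V] [DecidableEq E]
  {D : Matrix E V ℝ} {Γ : Matrix V V ℝ} {Λ : Matrix E E ℝ} {Q : Set (V → ℝ)}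
  {xs : ℕ → V → ℝ} {ys : ℕ → E → ℝ}

/-- The telescoped primal-dual gap estimate along the iterates. -/
lemma SLPSequences.sum_gap_le (hseq : SLPSequences D Γ Λ Q xs ys) (hΓ : Γ.PosDef)
    (hΛ : Λ.PosDef) (hQ : Convex ℝ Q)
    (hD : ∀ u v, u ⬝ᵥ (D *ᵥ v) ≤ (1 / 2) * (wnormSq Λ⁻¹ u + wnormSq Γ⁻¹ v))
    {x : V → ℝ} (hx : x ∈ Q) {y : E → ℝ} (hy : y ∈ linfBall E) (K : ℕ) :
    ∑ k ∈ Icc 1 K, (y ⬝ᵥ (D *ᵥ xs k) - ys k ⬝ᵥ (D *ᵥ x)) ≤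
      (1 / 2) * (wnormSq Γ⁻¹ (xs 0 - x) - wnormSq Γ⁻¹ (xs K - x)) +
      (1 / 2) * (wnormSq Λ⁻¹ (ys 0 - y) - wnormSq Λ⁻¹ (ys K - y)) +
      (y - ys K) ⬝ᵥ (D *ᵥ (xs K - xs (K - 1))) -
      (1 / 2) * wnormSq Γ⁻¹ (xs K - xs (K - 1)) := by
  induction K with
  | zero => simp
  | succ K ih =>
    rw [sum_Icc_succ_top (by omega), Nat.add_sub_cancel]
    have hdual := (hseq K).1.prox_descent hΛ (convex_linfBall E) hy
    have hmin : IsMinimizer Q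
        (fun z => (1 / 2) * wnormSq Γ⁻¹ (xs K - Γ *ᵥ (Dᵀ *ᵥ ys (K + 1)) - z)) (xs (K + 1)) :=
      (hseq K).2
    have hprimal : (x - xs (K + 1)) ⬝ᵥ (-(Dᵀ *ᵥ ys (K + 1))) ≤ _ :=
      IsMinimizer.prox_descent (c := xs K) hΓ hQ
        (by simpa only [mulVec_neg, ← sub_eq_add_neg] using hmin) hx
    rw [mulVec_transpose, dotProduct_neg, dotProduct_comm, ← dotProduct_mulVec] at hprimal
    have hcross := hD (ys (K + 1) - ys K) (xs K - xs (K - 1))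
    simp only [mulVec_sub, mulVec_smul, dotProduct_sub, sub_dotProduct, dotProduct_smul,
      smul_eq_mul] at hdual hprimal hcross ih ⊢
    linarith

/-- The ergodic primal-dual gap estimate. -/
lemma SLPSequences.sum_gap_le_initial (hseq : SLPSequences D Γ Λ Q xs ys) (hΓ : Γ.PosDef)
    (hΛ : Λ.PosDef) (hQ : Convex ℝ Q)
    (hD : ∀ u v, u ⬝ᵥ (D *ᵥ v) ≤ (1 / 2) * (wnormSq Λ⁻¹ u + wnormSq Γ⁻¹ v))
    {x : V → ℝ} (hx : x ∈ Q) {y : E → ℝ} (hy : y ∈ linfBall E) (K : ℕ) :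
    ∑ k ∈ Icc 1 K, (y ⬝ᵥ (D *ᵥ xs k) - ys k ⬝ᵥ (D *ᵥ x)) ≤
      (1 / 2) * (wnormSq Γ⁻¹ (xs 0 - x) + wnormSq Λ⁻¹ (ys 0 - y)) := by
  have hgap := hseq.sum_gap_le hΓ hΛ hQ hD hx hy K
  have hcross := hD (y - ys K) (xs K - xs (K - 1))
  rw [wnormSq_sub_comm _ y] at hcross
  have hnonneg : 0 ≤ wnormSq Γ⁻¹ (xs K - x) := hΓ.inv.posSemidef.dotProduct_mulVec_nonneg _
  linarith

/-- The ergodic convergence rate of the averaged primal iterates. -/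
lemma SLPSequences.l1Norm_average_sub_le (hseq : SLPSequences D Γ Λ Q xs ys) (hΓ : Γ.PosDef)
    (hΛ : Λ.PosDef) (hQ : Convex ℝ Q)
    (hD : ∀ u v, u ⬝ᵥ (D *ᵥ v) ≤ (1 / 2) * (wnormSq Λ⁻¹ u + wnormSq Γ⁻¹ v))
    {x : V → ℝ} (hx : x ∈ Q) {K : ℕ} (hK : 1 ≤ K) :
    l1Norm (D *ᵥ ((K : ℝ)⁻¹ • ∑ k ∈ Icc 1 K, xs k)) - l1Norm (D *ᵥ x) ≤
      (1 / (2 * K)) * (wnormSq Γ⁻¹ (xs 0 - x) +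
        wnormSq Λ⁻¹ (ys 0 - fun e =>
          Real.sign ((D *ᵥ ((K : ℝ)⁻¹ • ∑ k ∈ Icc 1 K, xs k)) e))) := by
  have hK0 : (0 : ℝ) < K := by exact_mod_cast hK
  set xbar := (K : ℝ)⁻¹ • ∑ k ∈ Icc 1 K, xs k with hxbar
  set y : E → ℝ := fun e => Real.sign ((D *ᵥ xbar) e)
  have hgap := hseq.sum_gap_le_initial hΓ hΛ hQ hD hx (sign_mem_linfBall (D *ᵥ xbar)) K
  have hsum : ∑ k ∈ Icc 1 K, y ⬝ᵥ (D *ᵥ xs k) = K * l1Norm (D *ᵥ xbar) := by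
    have hxs : ∑ k ∈ Icc 1 K, xs k = (K : ℝ) • xbar := by
      rw [hxbar, smul_inv_smul₀ hK0.ne']
    rw [← sign_dotProduct_self, ← dotProduct_sum, ← mulVec_sum, hxs, mulVec_smul,
      dotProduct_smul, smul_eq_mul]
  have hdual : ∑ k ∈ Icc 1 K, ys k ⬝ᵥ (D *ᵥ x) ≤ K * l1Norm (D *ᵥ x) := by
    have h : ∀ k ∈ Icc 1 K, ys k ⬝ᵥ (D *ᵥ x) ≤ l1Norm (D *ᵥ x) := by
      intro k hk
      obtain ⟨j, rfl⟩ := Nat.exists_eq_add_of_le' (mem_Icc.1 hk).1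
      exact dotProduct_le_l1Norm (hseq j).1.1 _
    simpa using sum_le_card_nsmul _ _ _ h
  rw [sum_sub_distrib, hsum] at hgap
  rw [one_div_mul_eq_div, le_div_iff₀ (by positivity)]
  linarith

end PrimalDual

namespace EmpiricalGraph

variable {V E : Type*} [DecidableEq V] (G : EmpiricalGraph V E)

lemma incidence_mulVec_apply [Fintype V] (v : V → ℝ) (e : E) :
    (G.incidence *ᵥ v) e = G.w e * (v (G.head e) - v (G.tail e)) := by
  have h : ∀ i, G.incidence e i * v i =
      (if G.head e = i then G.w e * v i else 0) - (if G.tail e = i then G.w e * v i else 0) := by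
    intro i
    have hne := G.no_self_loop e
    simp only [incidence, of_apply]
    split_ifs with h₁ h₂
    · exact absurd (h₁.trans h₂.symm) hne
    all_goals ring
  simp only [mulVec, dotProduct, h, sum_sub_distrib, sum_ite_eq, mem_univ, if_true]
  ring

lemma sum_deg_mul [Fintype E] [Fintype V] (f : V → ℝ) :
    ∑ i, G.deg i * f i = ∑ e, G.w e * (f (G.head e) + f (G.tail e)) := by
  simp only [deg, sum_mul]
  rw [sum_comm]
  refine sum_congr rfl fun e _ => ?_
  simp [add_mul, ite_mul, sum_add_distrib, mul_add]

lemma deg_pos_of_adj [Fintype E] {i j : V} (h : G.toSimpleGraph.Adj i j) : 0 < G.deg i := by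
  have hw := G.w_pos
  have hterm : ∀ e, 0 ≤ (if G.head e = i then G.w e else 0) +
      (if G.tail e = i then G.w e else 0) := by
    intro e
    have := (hw e).le
    split_ifs <;> positivity
  obtain ⟨-, ⟨e, he, -⟩ | ⟨e, -, he⟩⟩ := h
  all_goals
    refine sum_pos' (fun e _ => hterm e) ⟨e, mem_univ e, ?_⟩
    have := hw e
    rw [if_pos he]
    split_ifs <;> linarith

lemma deg_pos_or_isEmpty [Fintype E] (hconn : G.toSimpleGraph.Connected) :
    (∀ i, 0 < G.deg i) ∨ IsEmpty E := by
  rcases subsingleton_or_nontrivial V with hV | hV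
  · exact Or.inr ⟨fun e => G.no_self_loop e (Subsingleton.elim _ _)⟩
  · left
    intro i
    obtain ⟨j, hj⟩ := hconn.preconnected.exists_adj_of_nontrivial i
    exact G.deg_pos_of_adj hj

/-- The step sizes satisfy the stability condition of the primal-dual iteration. -/
lemma dotProduct_incidence_mulVec_le [Fintype V] [Fintype E] [DecidableEq E]
    (u : E → ℝ) (v : V → ℝ) :
    u ⬝ᵥ (G.incidence *ᵥ v) ≤
      (1 / 2) * (wnormSq (diagonal fun e => 2 * G.w e) u +
        wnormSq (diagonal fun i => 2 * G.deg i) v) := by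
  have hv : wnormSq (diagonal fun i => 2 * G.deg i) v =
      ∑ e, 2 * (G.w e * (v (G.head e) ^ 2 + v (G.tail e) ^ 2)) := by
    rw [← mul_sum, ← G.sum_deg_mul fun i => v i ^ 2, mul_sum]
    simp only [wnormSq, dotProduct, mulVec_diagonal]
    exact sum_congr rfl fun i _ => by ring
  have hu : wnormSq (diagonal fun e => 2 * G.w e) u = ∑ e, 2 * (G.w e * u e ^ 2) := by
    simp only [wnormSq, dotProduct, mulVec_diagonal]
    exact sum_congr rfl fun e _ => by ring
  rw [hu, hv, ← sum_add_distrib, mul_sum]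
  refine sum_le_sum fun e _ => ?_
  rw [incidence_mulVec_apply]
  set a := v (G.head e)
  set b := v (G.tail e)
  have hineq : u e * (a - b) ≤ u e ^ 2 + (a ^ 2 + b ^ 2) := by
    nlinarith [sq_nonneg (u e - a), sq_nonneg (u e + b), sq_nonneg a, sq_nonneg b]
  nlinarith [mul_le_mul_of_nonneg_left hineq (G.w_pos e).le]

end EmpiricalGraph

lemma inv_diagonal_one_div {ι : Type*} [Fintype ι] [DecidableEq ι] {c : ι → ℝ}
    (hc : ∀ i, 0 < c i) :
    (diagonal fun i => 1 / c i)⁻¹ = diagonal c := by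
  refine inv_eq_left_inv ?_
  rw [diagonal_mul_diagonal, ← diagonal_one]
  congr 1
  funext i
  exact mul_one_div_cancel (hc i).ne'

/-- Theorem 1, convergence bound for sparse label propagation:
for a connected empirical graph with sampling set `M`, labels `x̃`, step sizes
`Γ = diag(1/(2dᵢ))`, `Λ = diag(1/(2Wₑ))`, a TV-minimizer `x̂_SLP` over `Q`, a dual
certificate `ŷ_SLP` forming a saddle point of `L(x,y) = yᵀDx` with
`L(x̂_SLP, ŷ_SLP) = ‖D x̂_SLP‖₁`, and iterates of the SLP update rule, the averages
`x̄⁽ᴷ⁾ = (1/K) ∑_{k=1}^K x̂⁽ᵏ⁾` satisfy the `O(1/K)` bound on TV-suboptimality. -/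
theorem slp_convergence_bound
    {V E : Type*} [Fintype V] [Fintype E] [DecidableEq V] [DecidableEq E]
    (G : EmpiricalGraph V E)
    (hconn : G.toSimpleGraph.Connected)
    (M : Set V) (xtil : V → ℝ)
    (Q : Set (V → ℝ)) (hQ : Q = {x : V → ℝ | ∀ i ∈ M, x i = xtil i})
    (Γ : Matrix V V ℝ) (hΓ : Γ = Matrix.diagonal (fun i => 1 / (2 * G.deg i)))
    (Λ : Matrix E E ℝ) (hΛ : Λ = Matrix.diagonal (fun e => 1 / (2 * G.w e)))
    (D : Matrix E V ℝ) (hD : D = G.incidence)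
    (xSLP : V → ℝ) (ySLP : E → ℝ)
    (hxmin : IsMinimizer Q (fun x => l1Norm (D *ᵥ x)) xSLP)
    (hyball : ySLP ∈ linfBall E)
    (hsaddle₁ : ∀ y ∈ linfBall E, y ⬝ᵥ (D *ᵥ xSLP) ≤ ySLP ⬝ᵥ (D *ᵥ xSLP))
    (hsaddle₂ : ∀ x ∈ Q, ySLP ⬝ᵥ (D *ᵥ xSLP) ≤ ySLP ⬝ᵥ (D *ᵥ x))
    (hLval : ySLP ⬝ᵥ (D *ᵥ xSLP) = l1Norm (D *ᵥ xSLP))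
    (xs : ℕ → V → ℝ) (ys : ℕ → E → ℝ)
    (hseq : SLPSequences D Γ Λ Q xs ys) :
    ∀ K : ℕ, 1 ≤ K →
      l1Norm (D *ᵥ ((K : ℝ)⁻¹ • ∑ k ∈ Finset.Icc 1 K, xs k)) - l1Norm (D *ᵥ xSLP) ≤
        (1 / (2 * K)) *
          (wnormSq Γ⁻¹ (xs 0 - xSLP) +
            wnormSq Λ⁻¹
              (ys 0 - fun e =>
                Real.sign ((D *ᵥ ((K : ℝ)⁻¹ • ∑ k ∈ Finset.Icc 1 K, xs k)) e))) := by
  intro K hK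
  rcases G.deg_pos_or_isEmpty hconn with hdeg | hE
  · have hd : ∀ i, 0 < 2 * G.deg i := fun i => by linarith [hdeg i]
    have hw : ∀ e, 0 < 2 * G.w e := fun e => by linarith [G.w_pos e]
    refine hseq.l1Norm_average_sub_le ?_ ?_ (hQ ▸ convex_setOf_eqOn M xtil) ?_ hxmin.1 hK
    · exact hΓ ▸ PosDef.diagonal fun i => one_div_pos.2 (hd i)
    · exact hΛ ▸ PosDef.diagonal fun e => one_div_pos.2 (hw e)
    · rw [hΓ, hΛ, hD, inv_diagonal_one_div hd, inv_diagonal_one_div hw]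
      exact G.dotProduct_incidence_mulVec_le
  · have hΓ0 : Γ = 0 := by
      rw [hΓ]
      simp [EmpiricalGraph.deg]
    simp [l1Norm, wnormSq, dotProduct, hΓ0]

end
end

section
/- Consider the chain graph with N ≥ 3 nodes, weights W_{i,i+1} = 1/i, sampling set M = {1, N} with labels x̃_1 = 1 and x̃_N = 0, and the sparse label propagation message-passing iterations started from zero initialization x̂^{(−1)} = x̂^{(0)} = 0, ŷ^{(0)} = 0. Then for every K ≥ 1 the average x̄^{(K)} = (1/K) Σ_{k=1}^{K} x̂^{(k)} satisfies x̄^{(K)}[1] = 1 and x̄^{(K)}[i] = 0 for all i ∈ {K+1, …, N}. -/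
open Matrix Finset

noncomputable section

/-- Weight of the `e`-th edge of the chain graph: edge `e : Fin n` joins nodes
`e` and `e+1` (0-indexed; in 1-indexed paper notation `W_{i,i+1} = 1/i` with `i = e+1`). -/
def chainW {n : ℕ} (e : Fin n) : ℝ := 1 / (e.val + 1)

/-- Oriented incidence matrix of the chain graph with `n+1` nodes and `n` edges;
edge `e` has head `e⁺ = e` and tail `e⁻ = e+1`, entries `±W_e`. -/
def chainD (n : ℕ) : Matrix (Fin n) (Fin (n+1)) ℝ :=
  Matrix.of fun e i =>
    if i = e.castSucc then chainW e else if i = e.succ then -chainW e else 0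

/-- Weighted node degree of the chain graph. -/
def chainDeg (n : ℕ) (i : Fin (n+1)) : ℝ :=
  ∑ e : Fin n,
    ((if e.castSucc = i then chainW e else 0) + (if e.succ = i then chainW e else 0))

/-- Total variation on the chain graph: `‖z‖_TV = ∑_{i=1}^{N−1} (1/i) |z[i+1] − z[i]|`. -/
def chainTV (n : ℕ) (z : Fin (n+1) → ℝ) : ℝ :=
  ∑ e : Fin n, chainW e * |z e.succ - z e.castSucc|

/-- Clipping to the interval `[−1,1]`: `clip t = t / max {1, |t|}`. -/
def clip (t : ℝ) : ℝ := t / max 1 |t|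

/-- The SLP message-passing iterations on the chain graph with `n+1` nodes,
sampling set `M = {first node, last node}` with labels `1` and `0`, started from zero
initialization `x̂⁽⁻¹⁾ = x̂⁽⁰⁾ = 0`, `ŷ⁽⁰⁾ = 0` (the index `k − 1` uses truncated
subtraction, so `x̂⁽⁻¹⁾ = x̂⁽⁰⁾` is encoded by `0 - 1 = 0`).  With `x = 2x̂⁽ᵏ⁾ − x̂⁽ᵏ⁻¹⁾`:
`ŷ⁽ᵏ⁺¹⁾[e] = clip(ŷ⁽ᵏ⁾[e] + (x[e⁺] − x[e⁻])/2)`, then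
`x̂⁽ᵏ⁺¹⁾ = x̂⁽ᵏ⁾ − Γ Dᵀ ŷ⁽ᵏ⁺¹⁾` with `Γ = diag(1/(2dᵢ))`, and finally the sampled
nodes are reset to their labels. -/
def ChainSLPIter (n : ℕ) (xs : ℕ → Fin (n+1) → ℝ) (ys : ℕ → Fin n → ℝ) : Prop :=
  xs 0 = 0 ∧ ys 0 = 0 ∧
    ∀ k : ℕ,
      (∀ e : Fin n,
        ys (k+1) e =
          clip (ys k e +
            (((2:ℝ) • xs k - xs (k-1)) e.castSucc - ((2:ℝ) • xs k - xs (k-1)) e.succ) / 2)) ∧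
      (∀ i : Fin (n+1),
        xs (k+1) i =
          if i = 0 then 1
          else if i = Fin.last n then 0
          else xs k i - (1 / (2 * chainDeg n i)) * ((chainD n)ᵀ *ᵥ ys (k+1)) i)


/-- Information travels at most one edge per iteration: nodes at distance `k` or more from the
first node are still zero after `k` iterations, and so are the dual values on the edges there. -/
lemma ChainSLPIter.eq_zero_of_le {n : ℕ} {xs : ℕ → Fin (n+1) → ℝ} {ys : ℕ → Fin n → ℝ}
    (h : ChainSLPIter n xs ys) (k : ℕ) :
    (∀ j ≤ k, ∀ i : Fin (n+1), k ≤ i.val → xs j i = 0) ∧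
      ∀ e : Fin n, k ≤ e.val + 1 → ys k e = 0 := by
  obtain ⟨hx0, hy0, hstep⟩ := h
  induction k with
  | zero =>
    refine ⟨fun j hj i _ => ?_, fun e _ => by simp [hy0]⟩
    obtain rfl : j = 0 := by omega
    simp [hx0]
  | succ k ih =>
    obtain ⟨ihx, ihy⟩ := ih
    obtain ⟨hy, hx⟩ := hstep k
    have hy' : ∀ e : Fin n, k + 1 ≤ e.val + 1 → ys (k+1) e = 0 := by
      intro e he
      have hc : k ≤ e.castSucc.val := by simp; omega
      have hs : k ≤ e.succ.val := by simp; omega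
      rw [hy e, ihy e (by omega)]
      simp [clip, ihx k le_rfl _ hc, ihx k le_rfl _ hs, ihx (k-1) (by omega) _ hc,
        ihx (k-1) (by omega) _ hs]
    refine ⟨fun j hj i hi => ?_, hy'⟩
    rcases Nat.lt_or_ge k j with hjk | hjk
    · obtain rfl : j = k + 1 := by omega
      have hD : ((chainD n)ᵀ *ᵥ ys (k+1)) i = 0 := by
        simp only [Matrix.mulVec, dotProduct]
        refine Finset.sum_eq_zero fun e _ => ?_
        by_cases he : k + 1 ≤ e.val + 1
        · simp [hy' e he]
        · have h1 : i ≠ e.castSucc := by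
            rintro rfl
            simp at hi
            omega
          have h2 : i ≠ e.succ := by
            rintro rfl
            simp at hi
            omega
          simp [chainD, h1, h2]
      have hi0 : i ≠ 0 := by
        rintro rfl
        simp at hi
      rw [hx i, hD, ihx k le_rfl i (by omega)]
      simp [hi0]
    · exact ihx j hjk i (by omega)

/-- on the chain graph with `N = n+1 ≥ 3` nodes, weights `W_{i,i+1} = 1/i`,
sampling set `M = {1, N}` with labels `x̃₁ = 1`, `x̃_N = 0`, and SLP message-passing
iterations from zero initialization, the running average `x̄⁽ᴷ⁾ = (1/K) ∑_{k=1}^K x̂⁽ᵏ⁾`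
satisfies `x̄⁽ᴷ⁾[1] = 1` and `x̄⁽ᴷ⁾[i] = 0` for all (1-indexed) nodes `i ∈ {K+1,…,N}`,
i.e. all 0-indexed nodes `i` with `K ≤ i`. -/
theorem chain_slp_average_values
    (n : ℕ) (hn : 2 ≤ n)
    (xs : ℕ → Fin (n+1) → ℝ) (ys : ℕ → Fin n → ℝ)
    (hiter : ChainSLPIter n xs ys) :
    ∀ K : ℕ, 1 ≤ K →
      ((K : ℝ)⁻¹ • ∑ k ∈ Finset.Icc 1 K, xs k) 0 = 1 ∧
        ∀ i : Fin (n+1), K ≤ i.val →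
          ((K : ℝ)⁻¹ • ∑ k ∈ Finset.Icc 1 K, xs k) i = 0 := by
  intro K hK
  have hK0 : (K : ℝ) ≠ 0 := by positivity
  refine ⟨?_, fun i hi => ?_⟩
  · have hone : ∀ k ∈ Finset.Icc 1 K, xs k 0 = 1 := by
      intro k hk
      obtain ⟨m, rfl⟩ : ∃ m, k = m + 1 := ⟨k - 1, by have := (Finset.mem_Icc.mp hk).1; omega⟩
      simp [(hiter.2.2 m).2 0]
    rw [Pi.smul_apply, Finset.sum_apply, Finset.sum_congr rfl hone]
    simp [hK0]
  · rw [Pi.smul_apply, Finset.sum_apply, Finset.sum_eq_zero fun k hk =>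
      (hiter.eq_zero_of_le K).1 k (Finset.mem_Icc.mp hk).2 i hi, smul_zero]

end
end
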